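/- arXiv:1604.02659 — 4 statements merged into one kernel-verified Lean document; each statement's English description precedes it below -/
import Mathlib

section
/- Let A be an m×n real matrix, let k be a positive integer, and let 𝓘 be a nonempty collection of subsets of {1,…,n}, each of cardinality at most k. Let Σ_k = {x ∈ ℝⁿ : supp(x) ⊆ S for some S ∈ 𝓘} be the associated union of coordinate subspaces. Then the following are equivalent: (a) for every y ∈ ℝᵐ there exists at most one x ∈ Σ_k such that y = Ax; (b) for every S₁, S₂ ∈ 𝓘, the columns of A indexed by S₁ ∪ S₂ are linearly independent. -/
theorem columns_indep_iff {m n : ℕ} (A : Matrix (Fin m) (Fin n) ℝ) (T : Finset (Fin n)) :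
    LinearIndependent ℝ (fun j : ↥T => fun i : Fin m => A i j.val) ↔
      ∀ z : Fin n → ℝ, (∀ i, z i ≠ 0 → i ∈ T) → A.mulVec z = 0 → z = 0 := by
  have h1 : LinearIndependent ℝ (fun j : ↥T => fun i : Fin m => A i j.val) ↔
      ∀ g : Fin n → ℝ, ∑ j ∈ T, g j • (fun i : Fin m => A i j) = 0 → ∀ j ∈ T, g j = 0 :=
    linearIndepOn_finset_iff (R := ℝ) (v := fun j : Fin n => fun i : Fin m => A i j) (s := T)
  rw [h1]
  have key : ∀ z : Fin n → ℝ, (∀ i, z i ≠ 0 → i ∈ T) →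
      A.mulVec z = ∑ j ∈ T, z j • (fun i : Fin m => A i j) := by
    intro z hz
    ext i
    simp only [Matrix.mulVec, dotProduct, Finset.sum_apply, Pi.smul_apply, smul_eq_mul]
    symm
    rw [Finset.sum_congr rfl (fun j _ => mul_comm (z j) (A i j))]
    apply Finset.sum_subset (Finset.subset_univ T)
    intro j _ hj
    have : z j = 0 := by
      by_contra h
      exact hj (hz j h)
    simp [this]
  constructor
  · intro h z hz h0
    rw [key z hz] at h0
    ext j
    by_contra hj
    exact hj (h z h0 j (hz j hj))
  · intro h g hg j hj
    have hs : ∀ i, (fun i => if i ∈ T then g i else 0) i ≠ 0 → i ∈ T := by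
      intro i hi
      by_contra h'
      simp [h'] at hi
    have h2 := h (fun i => if i ∈ T then g i else 0) hs (by
      rw [key _ hs, ← hg]
      apply Finset.sum_congr rfl
      intro i hi
      simp [hi])
    have h3 := congrFun h2 j
    simpa [hj] using h3

/-- For an m×n real matrix `A`, a positive integer `k`, and a nonempty
collection `𝓘` of index sets each of cardinality at most `k`, uniqueness of
representations `y = A x` over the structured sparsity model
`Σ_k = {x : supp x ⊆ S for some S ∈ 𝓘}` is equivalent to linear independence of
the columns of `A` indexed by `S₁ ∪ S₂` for every `S₁, S₂ ∈ 𝓘`. -/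
theorem structured_sparse_uniqueness_iff
    (m n k : ℕ) (hk : 0 < k)
    (A : Matrix (Fin m) (Fin n) ℝ)
    (𝓘 : Set (Finset (Fin n))) (h𝓘 : 𝓘.Nonempty)
    (hcard : ∀ S ∈ 𝓘, S.card ≤ k) :
    (∀ y : Fin m → ℝ, ∀ x₁ x₂ : Fin n → ℝ,
        (∃ S ∈ 𝓘, ∀ i, x₁ i ≠ 0 → i ∈ S) →
        (∃ S ∈ 𝓘, ∀ i, x₂ i ≠ 0 → i ∈ S) →
        y = A.mulVec x₁ → y = A.mulVec x₂ → x₁ = x₂)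
    ↔ (∀ S₁ ∈ 𝓘, ∀ S₂ ∈ 𝓘,
        LinearIndependent ℝ (fun j : ↥(S₁ ∪ S₂) => fun i : Fin m => A i j.val)) := by
  simp only [columns_indep_iff]
  constructor
  · intro h S₁ h₁ S₂ h₂ z hz h0
    have e := h (A.mulVec (fun i => if i ∈ S₁ then z i else 0))
      (fun i => if i ∈ S₁ then z i else 0) (fun i => if i ∈ S₁ then 0 else - z i)
      ⟨S₁, h₁, by
        intro i hi
        by_contra h'
        simp [h'] at hi⟩
      ⟨S₂, h₂, by
        intro i hi
        by_cases h' : i ∈ S₁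
        · simp [h'] at hi
        · have := hz i (by simpa [h'] using hi)
          simpa [h'] using this⟩
      rfl (by
        rw [← sub_eq_zero, ← Matrix.mulVec_sub, ← h0]
        congr 1
        ext i
        by_cases h' : i ∈ S₁ <;> simp [h'])
    ext i
    have := congrFun e i
    by_cases h' : i ∈ S₁ <;> simpa [h'] using this
  · rintro h y x₁ x₂ ⟨S₁, h₁, hx₁⟩ ⟨S₂, h₂, hx₂⟩ e₁ e₂
    rw [← sub_eq_zero]
    apply h S₁ h₁ S₂ h₂
    · intro i hi
      rw [Finset.mem_union]
      by_contra! h'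
      have a : x₁ i = 0 := by
        by_contra c
        exact h'.1 (hx₁ i c)
      have b : x₂ i = 0 := by
        by_contra c
        exact h'.2 (hx₂ i c)
      simp [a, b] at hi
    · rw [Matrix.mulVec_sub, ← e₁, ← e₂, sub_self]
end

section
/- Let A be an m×n real matrix and let k be a positive integer with 2k ≤ n. If for every y ∈ ℝᵐ there exists at most one k-sparse vector x ∈ ℝⁿ (that is, a vector with at most k nonzero entries) such that y = Ax, then m ≥ 2k. -/
theorem ncard_extend_le {k n : ℕ} (f : Fin k → Fin n) (u : Fin k → ℝ) :
    Set.ncard {i | Function.ExtendByZero.linearMap ℝ f u i ≠ 0} ≤ k := by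
  have hsub : {i | Function.ExtendByZero.linearMap ℝ f u i ≠ 0} ⊆ Set.image f Set.univ := by
    intro i hi
    by_contra hc
    apply hi
    have hc' : ¬ ∃ a, f a = i := by simpa using hc
    change Function.extend f u 0 i = 0
    simp [Function.extend_apply' _ _ _ hc']
  calc _ ≤ (Set.image f Set.univ).ncard := Set.ncard_le_ncard hsub (Set.toFinite _)
    _ ≤ (Set.univ : Set (Fin k)).ncard := Set.ncard_image_le (Set.toFinite _)
    _ = k := by simp [Set.ncard_univ]

/-- If `A` is an m×n real matrix, `k` a positive integer with `2k ≤ n`,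
and the map `x ↦ A x` is injective on the set of k-sparse vectors
(at most one k-sparse solution of `y = A x` for every `y`), then `m ≥ 2k`. -/
theorem sparse_uniqueness_rows_ge
    (m n k : ℕ) (hk : 0 < k) (hkn : 2 * k ≤ n)
    (A : Matrix (Fin m) (Fin n) ℝ)
    (h : ∀ y : Fin m → ℝ, ∀ x₁ x₂ : Fin n → ℝ,
        Set.ncard {i | x₁ i ≠ 0} ≤ k →
        Set.ncard {i | x₂ i ≠ 0} ≤ k →
        y = A.mulVec x₁ → y = A.mulVec x₂ → x₁ = x₂) :
    m ≥ 2 * k := by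
  let f : Fin k → Fin n := fun i => ⟨i, by omega⟩
  let g : Fin k → Fin n := fun i => ⟨k + i, by omega⟩
  have hf : Function.Injective f := by
    intro a b hab
    simp only [f, Fin.mk.injEq] at hab
    exact Fin.ext hab
  have hg : Function.Injective g := by
    intro a b hab
    simp only [g, Fin.mk.injEq] at hab
    exact Fin.ext (by omega)
  have hfg : ∀ a b, f a ≠ g b := by
    intro a b hab
    simp only [f, g, Fin.mk.injEq] at hab
    omega
  let E := Function.ExtendByZero.linearMap ℝ f
  let F := Function.ExtendByZero.linearMap ℝ g
  let L : ((Fin k → ℝ) × (Fin k → ℝ)) →ₗ[ℝ] (Fin m → ℝ) :=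
    (A.mulVecLin ∘ₗ E).coprod (-(A.mulVecLin ∘ₗ F))
  have hL : Function.Injective L := by
    rw [injective_iff_map_eq_zero]
    rintro ⟨u, v⟩ huv
    have h1 : A.mulVec (E u) = A.mulVec (F v) := by
      have : A.mulVec (E u) + -A.mulVec (F v) = 0 := by simpa [L] using huv
      rwa [← sub_eq_add_neg, sub_eq_zero] at this
    have h2 : E u = F v :=
      h _ _ _ (ncard_extend_le f u) (ncard_extend_le g v) rfl h1
    have hu : u = 0 := by
      funext a
      have h3 : Function.extend f u 0 (f a) = Function.extend g v 0 (f a) := congrFun h2 (f a)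
      have hc : ¬ ∃ b, g b = f a := fun ⟨b, hb⟩ => hfg a b hb.symm
      simpa [hf.extend_apply,
        Function.extend_apply' _ _ _ hc] using h3
    have hv : v = 0 := by
      funext a
      have h3 : Function.extend f u 0 (g a) = Function.extend g v 0 (g a) := congrFun h2 (g a)
      have hc : ¬ ∃ b, f b = g a := fun ⟨b, hb⟩ => hfg b a hb
      simpa [hg.extend_apply,
        Function.extend_apply' _ _ _ hc] using h3.symm
    simp [hu, hv]
  have := LinearMap.finrank_le_finrank_of_injective hL
  simp at this
  omega
end

section
/- Let N, M, K be positive integers with M ≤ N and 5M > 8K (i.e., M > 8K/5), and let A be an M×N complex matrix such that every set of M columns of A is linearly independent (spark(A) = M+1). Then for any two K-structured supports S₁, S₂ ⊆ D, the family of Kronecker columns {φ(i,j) : (i,j) ∈ S₁ ∪ S₂} is a linearly independent family of vectors in ℂ^{M²}. -/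
/-- `(i,j)` lies on the −1-, 0- or 1-diagonal, i.e. `|i − j| ≤ 1`
(indices are 0-based here; in the paper they run over `{1,…,N}`). -/
def OnDiag {N : ℕ} (i j : Fin N) : Prop :=
  i.val ≤ j.val + 1 ∧ j.val ≤ i.val + 1

/-- `(i,j)` lies on the −1-, 0- or 1-anti-diagonal, i.e. `N ≤ i + j ≤ N + 2`
in 1-based indexing (the 1-based indices are `i.val + 1` and `j.val + 1`). -/
def OnAnti {N : ℕ} (i j : Fin N) : Prop :=
  N ≤ i.val + j.val + 2 ∧ i.val + j.val + 2 ≤ N + 2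

/-- The set `D` of admissible pairs: the positions of the −1-, 0- and 1-diagonals
and the −1-, 0- and 1-anti-diagonals of an N×N matrix. -/
def IsAdmissible {N : ℕ} (p : Fin N × Fin N) : Prop :=
  OnDiag p.1 p.2 ∨ OnAnti p.1 p.2

/-- The Kronecker column `φ(i,j) ∈ ℂ^{M²}`, with entries
`φ(i,j)_(p,q) = conj(A p i) * A q j`. -/
def kronCol {M N : ℕ} (A : Matrix (Fin M) (Fin N) ℂ) (ij : Fin N × Fin N) :
    Fin M × Fin M → ℂ :=
  fun pq => (starRingEnd ℂ) (A pq.1 ij.1) * A pq.2 ij.2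

/-- A K-structured support: a set `S ⊆ D` such that each row index carries at most one
diagonal pair and at most one anti-diagonal pair, the set `R(S)` of occurring row
indices is symmetric (`i ∈ R(S) → N+1−i ∈ R(S)`, i.e. `i.rev ∈ R(S)` in 0-based
indexing), and `|R(S)| ≤ K`. -/
def IsStructuredSupport (N K : ℕ) (S : Finset (Fin N × Fin N)) : Prop :=
  (∀ p ∈ S, IsAdmissible p) ∧
  (∀ i j j' : Fin N, (i, j) ∈ S → (i, j') ∈ S → OnDiag i j → OnDiag i j' → j = j') ∧
  (∀ i j j' : Fin N, (i, j) ∈ S → (i, j') ∈ S → OnAnti i j → OnAnti i j' → j = j') ∧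
  (∀ i : Fin N, i ∈ S.image Prod.fst → i.rev ∈ S.image Prod.fst) ∧
  (S.image Prod.fst).card ≤ K

/-- Key lemma: a nonzero entry `X p c` is impossible if the rows outside a small set `W`
avoid `c` and only use columns in a small set `T` containing the support of row `p`. -/
lemma kron_key {N M : ℕ} (hMN : M ≤ N) (A : Matrix (Fin M) (Fin N) ℂ)
    (hspark : ∀ T : Finset (Fin N), T.card = M →
        LinearIndependent ℂ (fun j : ↥T => fun p : Fin M => A p j.val))
    (X : Fin N → Fin N → ℂ)
    (hX : ∀ q r : Fin M, ∑ i, ∑ j, X i j * ((starRingEnd ℂ) (A q i) * A r j) = 0)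
    (p c : Fin N) (hpc : X p c ≠ 0) (T W : Finset (Fin N)) (hT : T.card ≤ M) (hW : W.card ≤ M)
    (hp : ∀ j, X p j ≠ 0 → j ∈ T)
    (hout : ∀ i, i ∉ W → X i c = 0 ∧ ∀ j, X i j ≠ 0 → j ∈ T) : False := by
  classical
  obtain ⟨T', hTT', hT'⟩ := Finset.exists_superset_card_eq hT (by simpa using hMN)
  obtain ⟨W', hWW', hW'⟩ := Finset.exists_superset_card_eq hW (by simpa using hMN)
  have hcT : c ∈ T' := hTT' (hp c hpc)
  have hli := hspark T' hT'
  obtain ⟨f, hf1, hf0⟩ : ∃ f : (Fin M → ℂ) →ₗ[ℂ] ℂ, f (fun p => A p c) = 1 ∧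
      ∀ j ∈ T', j ≠ c → f (fun p => A p j) = 0 := by
    have : Nonempty T' := ⟨⟨c, hcT⟩⟩
    let b := basisOfLinearIndependentOfCardEqFinrank hli (by simp [hT'])
    have hb : ∀ j : T', b j = fun p => A p j.val := by
      intro j; simp [b]
    refine ⟨b.coord ⟨c, hcT⟩, ?_, ?_⟩
    · rw [← hb ⟨c, hcT⟩]; simp
    · intro j hj hjc
      rw [← hb ⟨j, hj⟩]
      simp [hjc]
  set v : Fin N → ℂ := fun i => ∑ j, X i j * f (fun p => A p j) with hv
  have hrow : ∀ i, (∀ j, X i j ≠ 0 → j ∈ T) → v i = X i c := by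
    intro i hi
    rw [hv]
    simp only
    rw [Finset.sum_eq_single c]
    · rw [hf1, mul_one]
    · intro j _ hjc
      by_cases h : X i j = 0
      · simp [h]
      · rw [hf0 j (hTT' (hi j h)) hjc, mul_zero]
    · simp
  have hvp : v p ≠ 0 := by rw [hrow p hp]; exact hpc
  have hv0 : ∀ i, i ∉ W' → v i = 0 := by
    intro i hi
    have := hout i (fun h => hi (hWW' h))
    rw [hrow i this.2, this.1]
  have hpW : p ∈ W' := by
    by_contra h; exact hvp (hv0 p h)
  have hsum : ∀ q, ∑ i, v i * (starRingEnd ℂ) (A q i) = 0 := by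
    intro q
    have h1 : ∑ i, ∑ j, (X i j * (starRingEnd ℂ) (A q i)) • (fun r => A r j) = (0 : Fin M → ℂ) := by
      ext r
      have := hX q r
      simp only [Finset.sum_apply, Pi.smul_apply, smul_eq_mul, Pi.zero_apply]
      rw [← this]
      simp only [mul_assoc]
    have h2 := congrArg f h1
    simp only [map_sum, map_smul, map_zero, smul_eq_mul] at h2
    rw [← h2]
    refine Finset.sum_congr rfl fun i _ => ?_
    rw [hv]
    simp only [Finset.sum_mul]
    refine Finset.sum_congr rfl fun j _ => ?_
    ring
  have hliW := Fintype.linearIndependent_iff.1 (hspark W' hW')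
    (fun i => (starRingEnd ℂ) (v i)) (by
      ext q
      simp only [Finset.sum_apply, Pi.smul_apply, smul_eq_mul, Pi.zero_apply]
      rw [Finset.sum_coe_sort W' (fun i => (starRingEnd ℂ) (v i) * A q i)]
      have h3 : ∑ i ∈ W', (starRingEnd ℂ) (v i) * A q i
          = ∑ i, (starRingEnd ℂ) (v i) * A q i := by
        refine Finset.sum_subset (Finset.subset_univ _) ?_
        intro i _ hi
        simp [hv0 i hi]
      rw [h3]
      have h4 := congrArg (starRingEnd ℂ) (hsum q)
      simpa using h4) ⟨p, hpW⟩
  exact hvp (by simpa using hliW)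

/-- Each row of a structured support has at most two entries. -/
lemma structured_row_card {N K : ℕ} {S : Finset (Fin N × Fin N)}
    (h : IsStructuredSupport N K S) (i : Fin N) :
    (Finset.univ.filter (fun j => (i, j) ∈ S)).card ≤ 2 := by
  classical
  obtain ⟨ha, hd, hanti, -, -⟩ := h
  have hsub : Finset.univ.filter (fun j => (i, j) ∈ S) ⊆
      Finset.univ.filter (fun j => (i, j) ∈ S ∧ OnDiag i j) ∪
      Finset.univ.filter (fun j => (i, j) ∈ S ∧ OnAnti i j) := by
    intro j hj
    simp only [Finset.mem_filter, Finset.mem_univ, true_and, Finset.mem_union] at hj ⊢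
    rcases ha _ hj with h | h
    · exact Or.inl ⟨hj, h⟩
    · exact Or.inr ⟨hj, h⟩
  have h1 : (Finset.univ.filter (fun j => (i, j) ∈ S ∧ OnDiag i j)).card ≤ 1 := by
    rw [Finset.card_le_one]
    intro a ha b hb
    simp only [Finset.mem_filter, Finset.mem_univ, true_and] at ha hb
    exact hd i a b ha.1 hb.1 ha.2 hb.2
  have h2 : (Finset.univ.filter (fun j => (i, j) ∈ S ∧ OnAnti i j)).card ≤ 1 := by
    rw [Finset.card_le_one]
    intro a ha b hb
    simp only [Finset.mem_filter, Finset.mem_univ, true_and] at ha hb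
    exact hanti i a b ha.1 hb.1 ha.2 hb.2
  have := Finset.card_le_card hsub
  have := Finset.card_union_le (Finset.univ.filter (fun j => (i, j) ∈ S ∧ OnDiag i j))
    (Finset.univ.filter (fun j => (i, j) ∈ S ∧ OnAnti i j))
  omega

/-- For `K = 1` each row has at most one entry. -/
lemma structured_row_card_one {N : ℕ} {S : Finset (Fin N × Fin N)}
    (h : IsStructuredSupport N 1 S) (i : Fin N) :
    (Finset.univ.filter (fun j => (i, j) ∈ S)).card ≤ 1 := by
  classical
  obtain ⟨ha, hd, hanti, hs, hc⟩ := h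
  rw [Finset.card_le_one]
  intro a haS b hbS
  simp only [Finset.mem_filter, Finset.mem_univ, true_and] at haS hbS
  have hi : i ∈ S.image Prod.fst := Finset.mem_image.2 ⟨_, haS, rfl⟩
  have hrev : i.rev = i := Finset.card_le_one.1 hc _ (hs i hi) _ hi
  have hval : N - (i.val + 1) = i.val := by
    have := congrArg Fin.val hrev
    simpa [Fin.val_rev] using this
  have hlt := i.isLt
  have key : ∀ j, (i, j) ∈ S → OnDiag i j := by
    intro j hj
    rcases ha _ hj with h | h
    · exact h
    · simp only [OnAnti, OnDiag] at h ⊢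
      omega
  exact hd i a b haS hbS (key a haS) (key b hbS)

/-- Each column has at most six admissible rows. -/
lemma admissible_col_card {N : ℕ} (E : Finset (Fin N × Fin N)) (hE : ∀ p ∈ E, IsAdmissible p)
    (c : Fin N) : (Finset.univ.filter (fun i => (i, c) ∈ E)).card ≤ 6 := by
  classical
  have hsub : (Finset.univ.filter (fun i => (i, c) ∈ E)).image Fin.val ⊆
      Finset.Icc (c.val - 1) (c.val + 1) ∪ Finset.Icc (N - 2 - c.val) (N - c.val) := by
    intro x hx
    simp only [Finset.mem_image, Finset.mem_filter, Finset.mem_univ, true_and] at hx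
    obtain ⟨i, hi, rfl⟩ := hx
    simp only [Finset.mem_union, Finset.mem_Icc]
    rcases hE _ hi with h | h
    · simp only [OnDiag] at h; omega
    · simp only [OnAnti] at h; omega
  have h1 := Finset.card_le_card hsub
  rw [Finset.card_image_of_injective _ Fin.val_injective] at h1
  have h2 := Finset.card_union_le (Finset.Icc (c.val - 1) (c.val + 1))
    (Finset.Icc (N - 2 - c.val) (N - c.val))
  simp only [Nat.card_Icc] at h2
  omega

/-- A symmetric set of odd cardinality contains a fixed point of `Fin.rev`. -/
lemma exists_rev_fixed {N : ℕ} (R : Finset (Fin N)) (hR : ∀ i ∈ R, i.rev ∈ R)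
    (hodd : Odd R.card) : ∃ i ∈ R, i.rev = i := by
  classical
  by_contra! hcon
  have h : ∑ i ∈ R, (1 : ZMod 2) = 0 :=
    Finset.sum_involution (fun i _ => i.rev) (fun _ _ => by decide)
      (fun i hi _ => hcon i hi) (fun i hi => hR i hi) (fun i _ => Fin.rev_rev i)
  simp only [Finset.sum_const, nsmul_eq_mul, mul_one] at h
  rw [ZMod.natCast_eq_zero_iff_even] at h
  exact (Nat.not_even_iff_odd.2 hodd) h

theorem kron_columns_linearIndependent_of_structured
    (N M K : ℕ) (hN : 0 < N) (hM : 0 < M) (hK : 0 < K)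
    (hMN : M ≤ N) (hrate : 5 * M > 8 * K)
    (A : Matrix (Fin M) (Fin N) ℂ)
    (hspark : ∀ T : Finset (Fin N), T.card = M →
        LinearIndependent ℂ (fun j : ↥T => fun p : Fin M => A p j.val))
    (S₁ S₂ : Finset (Fin N × Fin N))
    (h₁ : IsStructuredSupport N K S₁) (h₂ : IsStructuredSupport N K S₂) :
    LinearIndependent ℂ (fun p : ↥(S₁ ∪ S₂) => kronCol A p.val) := by
  classical
  suffices hmain : LinearIndepOn ℂ (kronCol A) (↑(S₁ ∪ S₂) : Set (Fin N × Fin N)) from hmain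
  rw [linearIndepOn_finset_iff]
  intro g hg
  by_contra! hcon
  obtain ⟨⟨p₀, c₀⟩, hpE, hp0⟩ := hcon
  set E := S₁ ∪ S₂ with hE
  let X : Fin N → Fin N → ℂ := fun i j => if (i, j) ∈ E then g (i, j) else 0
  have hXE : ∀ i j, X i j ≠ 0 → (i, j) ∈ E := by
    intro i j h
    by_contra h'
    exact h (by simp [X, h'])
  have hX0 : X p₀ c₀ ≠ 0 := by simpa [X, hpE] using hp0
  have hX : ∀ q r : Fin M, ∑ i, ∑ j, X i j * ((starRingEnd ℂ) (A q i) * A r j) = 0 := by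
    intro q r
    have h := congrFun hg (q, r)
    simp only [Finset.sum_apply, Pi.smul_apply, smul_eq_mul, Pi.zero_apply, kronCol] at h
    rw [← h, ← Finset.sum_product', Finset.univ_product_univ]
    rw [← Finset.sum_subset (Finset.subset_univ E)]
    · refine Finset.sum_congr rfl ?_
      rintro ⟨i, j⟩ hij
      simp [X, hij]
    · rintro ⟨i, j⟩ _ hij
      simp [X, hij]
  have key := kron_key hMN A hspark X hX
  -- supports
  set R₁ := S₁.image Prod.fst with hR₁
  set R₂ := S₂.image Prod.fst with hR₂
  set R := R₁ ∪ R₂ with hR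
  have hER : ∀ i j, (i, j) ∈ E → i ∈ R := by
    intro i j h
    rcases Finset.mem_union.1 h with h | h
    · exact Finset.mem_union_left _ (Finset.mem_image.2 ⟨_, h, rfl⟩)
    · exact Finset.mem_union_right _ (Finset.mem_image.2 ⟨_, h, rfl⟩)
  have hc1 : R₁.card ≤ K := h₁.2.2.2.2
  have hc2 : R₂.card ≤ K := h₂.2.2.2.2
  have hcR : R.card + (R₁ ∩ R₂).card = R₁.card + R₂.card := Finset.card_union_add_card_inter _ _
  let Nb : Fin N → Finset (Fin N) := fun i => Finset.univ.filter (fun j => (i, j) ∈ E)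
  have hNbU : ∀ i, Nb i = Finset.univ.filter (fun j => (i, j) ∈ S₁) ∪
      Finset.univ.filter (fun j => (i, j) ∈ S₂) := by
    intro i; ext j; simp [Nb, hE]
  have hNbc : ∀ i, (Nb i).card ≤ (Finset.univ.filter (fun j => (i, j) ∈ S₁)).card +
      (Finset.univ.filter (fun j => (i, j) ∈ S₂)).card := by
    intro i; rw [hNbU]; exact Finset.card_union_le _ _
  have hNb4 : ∀ i, (Nb i).card ≤ 4 := by
    intro i
    have := hNbc i
    have := structured_row_card h₁ i
    have := structured_row_card h₂ i
    omega
  have hXNb : ∀ i j, X i j ≠ 0 → j ∈ Nb i := by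
    intro i j h
    simpa [Nb] using hXE i j h
  have hXR : ∀ i, i ∉ R → ∀ j, X i j = 0 := by
    intro i hi j
    by_contra h
    exact hi (hER i j (hXE i j h))
  -- Case 1: few rows
  by_cases hRM : R.card ≤ M
  · have hNbM : (Nb p₀).card ≤ M := by
      by_cases hK1 : K = 1
      · subst hK1
        have := hNbc p₀
        have := structured_row_card_one h₁ p₀
        have := structured_row_card_one h₂ p₀
        omega
      · have := hNb4 p₀
        omega
    exact key p₀ c₀ hX0 (Nb p₀) R hNbM hRM (hXNb p₀)
      (fun i hi => ⟨hXR i hi c₀, fun j hj => absurd (hXR i hi j) hj⟩)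
  -- then `M ≥ 6`
  have hM6 : 6 ≤ M := by
    by_contra hlt
    have hK3 : K = 3 := by omega
    subst hK3
    have e1 : R₁.card = 3 := by omega
    have e2 : R₂.card = 3 := by omega
    have e3 : (R₁ ∩ R₂).card = 0 := by omega
    obtain ⟨i, hi, hi'⟩ := exists_rev_fixed R₁ h₁.2.2.2.1 (by rw [e1]; decide)
    obtain ⟨j, hj, hj'⟩ := exists_rev_fixed R₂ h₂.2.2.2.1 (by rw [e2]; decide)
    have hij : i = j := by
      have a := congrArg Fin.val hi'
      have b := congrArg Fin.val hj'
      simp only [Fin.val_rev] at a b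
      apply Fin.ext
      omega
    subst hij
    rw [Finset.card_eq_zero] at e3
    have : i ∈ R₁ ∩ R₂ := Finset.mem_inter.2 ⟨hi, hj⟩
    rw [e3] at this
    simp at this
  set C : Finset (Fin N) := Finset.univ.filter (fun j => ∃ i, X i j ≠ 0) with hC
  have hXC : ∀ i j, X i j ≠ 0 → j ∈ C := by
    intro i j h
    simp only [hC, Finset.mem_filter, Finset.mem_univ, true_and]
    exact ⟨i, h⟩
  -- Case 2: few columns
  by_cases hCM : C.card ≤ M
  · have hadm : ∀ p ∈ E, IsAdmissible p := by
      intro p hp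
      rcases Finset.mem_union.1 hp with h | h
      · exact h₁.1 p h
      · exact h₂.1 p h
    refine key p₀ c₀ hX0 C (Finset.univ.filter (fun i => (i, c₀) ∈ E)) hCM
      ((admissible_col_card E hadm c₀).trans hM6) (hXC p₀) (fun i hi => ⟨?_, hXC i⟩)
    by_contra h
    exact hi (by simpa using hXE i c₀ h)
  -- Case 3: many rows and columns
  have hgen : ∀ d k : ℕ, (∀ i, (Nb i).card ≤ d) → d * (k + 1) ≤ M → R.card ≤ M + k →
      k ≤ R.card → False := by
    intro d k hd hk1 hk2 hk3
    obtain ⟨Q, hQR, hQ⟩ := Finset.exists_subset_card_eq hk3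
    have hBc : (Q.biUnion Nb).card ≤ k * d := by
      rw [← hQ]; exact Finset.card_biUnion_le_card_mul _ _ _ (fun i _ => hd i)
    have hkd : k * d + d ≤ M := by
      calc k * d + d = d * (k + 1) := by ring
        _ ≤ M := hk1
    obtain ⟨c, hcC, hcB⟩ : ∃ c ∈ C, c ∉ Q.biUnion Nb :=
      Finset.exists_mem_notMem_of_card_lt_card (by omega)
    obtain ⟨p, hp⟩ : ∃ i, X i c ≠ 0 := by simpa [hC] using hcC
    have hTc := Finset.card_union_le (Q.biUnion Nb) (Nb p)
    have hdp := hd p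
    refine key p c hp (Q.biUnion Nb ∪ Nb p) (R \ Q) (by omega) ?_ ?_ ?_
    · rw [Finset.card_sdiff_of_subset hQR]; omega
    · intro j hj
      exact Finset.mem_union_right _ (hXNb p j hj)
    · intro i hi
      by_cases hiR : i ∈ R
      · have hiQ : i ∈ Q := by
          by_contra h
          exact hi (Finset.mem_sdiff.2 ⟨hiR, h⟩)
        have hj : ∀ j, X i j ≠ 0 → j ∈ Q.biUnion Nb := fun j hj =>
          Finset.mem_biUnion.2 ⟨i, hiQ, hXNb i j hj⟩
        refine ⟨?_, fun j hj' => Finset.mem_union_left _ (hj j hj')⟩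
        by_contra h
        exact hcB (hj c h)
      · exact ⟨hXR i hiR c, fun j hj => absurd (hXR i hiR j) hj⟩
  by_cases ht : R.card = 2 * K
  · refine hgen 2 (M / 2 - 1) ?_ (by omega) (by omega) (by omega)
    intro i
    have e3 : (R₁ ∩ R₂).card = 0 := by omega
    rw [Finset.card_eq_zero] at e3
    have hempty : ∀ S : Finset (Fin N × Fin N), i ∉ S.image Prod.fst →
        (Finset.univ.filter (fun j => (i, j) ∈ S)).card = 0 := by
      intro S hi
      rw [Finset.card_eq_zero, Finset.filter_eq_empty_iff]
      intro j _ hj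
      exact hi (Finset.mem_image.2 ⟨_, hj, rfl⟩)
    have a := hNbc i
    have b1 := structured_row_card h₁ i
    have b2 := structured_row_card h₂ i
    by_cases hi : i ∈ R₁
    · have hi2 : i ∉ R₂ := by
        intro h
        have : i ∈ R₁ ∩ R₂ := Finset.mem_inter.2 ⟨hi, h⟩
        rw [e3] at this
        simp at this
      have := hempty S₂ hi2
      omega
    · have := hempty S₁ hi
      omega
  · exact hgen 4 (M / 4 - 1) hNb4 (by omega) (by omega) (by omega)
end

section
/- Let N, M, K be positive integers with M ≤ N and 5M > 8K (i.e., M > 8K/5), and let A be an M×N complex matrix such that every set of M columns of A is linearly independent (spark(A) = M+1). Let Σ_{2K} denote the set of vectors r : D → ℂ whose support {(i,j) ∈ D : r(i,j) ≠ 0} is contained in some K-structured support. Then the linear map r ↦ Σ_{(i,j)∈D} r(i,j)·φ(i,j) ∈ ℂ^{M²} is injective on Σ_{2K}: if r₁, r₂ ∈ Σ_{2K} satisfy Σ_{(i,j)∈D} r₁(i,j)·φ(i,j) = Σ_{(i,j)∈D} r₂(i,j)·φ(i,j), then r₁ = r₂. -/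
instance {N : ℕ} : DecidablePred (@IsAdmissible N) := fun p => by
  unfold IsAdmissible OnDiag OnAnti; infer_instance

open Finset in
/-- Vectors in the kernel of `A` with small support vanish. -/
lemma spark_aux {M N : ℕ} (hMN : M ≤ N) (A : Matrix (Fin M) (Fin N) ℂ)
    (hspark : ∀ T : Finset (Fin N), T.card = M →
        LinearIndependent ℂ (fun j : ↥T => fun p : Fin M => A p j.val))
    (f : Fin N → ℂ) (T : Finset (Fin N)) (hT : T.card ≤ M)
    (hf : ∀ j, f j ≠ 0 → j ∈ T) (h0 : ∀ p, ∑ j, f j * A p j = 0) : ∀ j, f j = 0 := by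
  obtain ⟨T', hTT', -, hT'⟩ := Finset.exists_subsuperset_card_eq (Finset.subset_univ T) hT
    (by simpa using hMN)
  have hli := Fintype.linearIndependent_iff.1 (hspark T' hT') (fun j => f j.val) (by
    ext p
    simp only [Finset.sum_apply, Pi.smul_apply, smul_eq_mul, Pi.zero_apply]
    rw [Finset.sum_coe_sort T' (fun j => f j * A p j), ← h0 p]
    apply Finset.sum_subset (Finset.subset_univ _)
    intro j _ hj
    by_cases h : f j = 0
    · simp [h]
    · exact absurd (hTT' (hf j h)) hj)
  intro j
  by_contra h
  exact h (hli ⟨j, hTT' (hf j h)⟩)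

/-- The conjugate version. -/
lemma spark_conj {M N : ℕ} (hMN : M ≤ N) (A : Matrix (Fin M) (Fin N) ℂ)
    (hspark : ∀ T : Finset (Fin N), T.card = M →
        LinearIndependent ℂ (fun j : ↥T => fun p : Fin M => A p j.val))
    (f : Fin N → ℂ) (T : Finset (Fin N)) (hT : T.card ≤ M)
    (hf : ∀ j, f j ≠ 0 → j ∈ T) (h0 : ∀ p, ∑ j, f j * (starRingEnd ℂ) (A p j) = 0) :
    ∀ j, f j = 0 := by
  have := spark_aux hMN A hspark (fun j => (starRingEnd ℂ) (f j)) T hT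
    (fun j hj => hf j (by simpa using hj)) (by
      intro p
      have := congrArg (starRingEnd ℂ) (h0 p)
      simpa using this)
  intro j
  simpa using this j

/-- No large independent family of rows touching few columns. -/
lemma no_indep_rows {M N : ℕ} (hMN : M ≤ N) (A : Matrix (Fin M) (Fin N) ℂ)
    (hspark : ∀ T : Finset (Fin N), T.card = M →
        LinearIndependent ℂ (fun j : ↥T => fun p : Fin M => A p j.val))
    (X : Fin N → Fin N → ℂ)
    (hX : ∀ p q, ∑ i, ∑ j, X i j * ((starRingEnd ℂ) (A p i) * A q j) = 0)
    (R : Finset (Fin N)) (hR : ∀ i j, X i j ≠ 0 → i ∈ R)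
    (I C : Finset (Fin N)) (hI : LinearIndepOn ℂ X (I : Set (Fin N)))
    (hne : I.Nonempty) (hIR : I ⊆ R) (hcard : R.card + 1 ≤ I.card + M)
    (hC : ∀ i ∈ I, ∀ j, X i j ≠ 0 → j ∈ C) (hCM : C.card ≤ M) : False := by
  classical
  let b : Fin N → (Fin M → ℂ) := fun i q => ∑ j, X i j * A q j
  have hb : LinearIndependent ℂ (fun i : I => b i) := by
    rw [Fintype.linearIndependent_iff]
    intro c hc
    have hz := spark_aux hMN A hspark (fun j => ∑ i : I, c i * X i j) C hCM (by
      intro j hj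
      obtain ⟨i, -, hi⟩ := Finset.exists_ne_zero_of_sum_ne_zero hj
      exact hC i i.2 j (right_ne_zero_of_mul hi)) (by
      intro q
      have := congrFun hc q
      simp only [Finset.sum_apply, Pi.smul_apply, smul_eq_mul, Pi.zero_apply, b] at this
      rw [← this]
      simp only [Finset.sum_mul, Finset.mul_sum]
      rw [Finset.sum_comm]
      simp only [mul_assoc])
    refine Fintype.linearIndependent_iff.1 (show LinearIndependent ℂ (fun i : I => X i) from hI) c ?_
    ext j
    simpa using hz j
  obtain ⟨i0, hi0⟩ := hne
  have hex : ∃ f : (Fin M → ℂ) →ₗ[ℂ] ℂ, ∀ i : I, f (b i) = if i = ⟨i0, hi0⟩ then 1 else 0 := by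
    let g := (Module.Basis.span hb).coord ⟨i0, hi0⟩
    obtain ⟨f, hf⟩ := LinearMap.exists_extend g
    refine ⟨f, fun i => ?_⟩
    have h1 : f (b i) = g (Module.Basis.span hb i) := by
      rw [← hf]; simp [Module.Basis.span_apply]
    rw [h1]
    simp [g, Finsupp.single_apply]
  obtain ⟨f, hf⟩ := hex
  have hfb : ∀ i, f (b i) = ∑ q, b i q * f (Pi.single q 1) := by
    intro i
    rw [LinearMap.pi_apply_eq_sum_univ f (b i)]
    refine Finset.sum_congr rfl fun q _ => ?_
    simp only [smul_eq_mul]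
    congr 2
    ext k
    simp [Pi.single_apply, eq_comm]
  have hv := spark_conj hMN A hspark (fun i => f (b i)) (R \ (I.erase i0)) (by
      have h1 := Finset.card_sdiff_add_card_eq_card ((Finset.erase_subset i0 I).trans hIR)
      have h2 := Finset.card_erase_add_one hi0
      omega) (by
      intro i hi
      rw [Finset.mem_sdiff]
      constructor
      · by_contra hn
        apply hi
        have : b i = 0 := by
          ext q
          simp only [b, Pi.zero_apply]
          refine Finset.sum_eq_zero fun j _ => ?_
          have : X i j = 0 := by
            by_contra h
            exact hn (hR i j h)
          simp [this]
        simp [this]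
      · intro hm
        obtain ⟨hne, hm⟩ := Finset.mem_erase.1 hm
        apply hi
        have := hf ⟨i, hm⟩
        simpa [hne] using this) (by
      intro p
      simp only [hfb, b, Finset.sum_mul]
      rw [Finset.sum_comm]
      refine Finset.sum_eq_zero fun q _ => ?_
      have := congrArg (fun z => z * f (Pi.single q 1)) (hX p q)
      simp only [Finset.sum_mul, zero_mul] at this
      rw [← this]
      refine Finset.sum_congr rfl fun i _ => Finset.sum_congr rfl fun j _ => ?_
      ring)
  have h1 := hf ⟨i0, hi0⟩
  have h2 := hv i0
  simp only at h1 h2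
  rw [h2] at h1
  simp at h1

/-- Row bound for a structured support. -/
lemma row_card {N K : ℕ} {S : Finset (Fin N × Fin N)} (hS : IsStructuredSupport N K S)
    (i : Fin N) : (Finset.univ.filter (fun j => (i, j) ∈ S)).card ≤ 2 := by
  classical
  obtain ⟨hadm, hd, ha, -, -⟩ := hS
  have hsub : Finset.univ.filter (fun j => (i, j) ∈ S) ⊆
      Finset.univ.filter (fun j => (i, j) ∈ S ∧ OnDiag i j) ∪
      Finset.univ.filter (fun j => (i, j) ∈ S ∧ OnAnti i j) := by
    intro j hj
    simp only [Finset.mem_filter, Finset.mem_univ, true_and, Finset.mem_union] at hj ⊢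
    rcases hadm _ hj with h | h
    · exact Or.inl ⟨hj, h⟩
    · exact Or.inr ⟨hj, h⟩
  have h1 : (Finset.univ.filter (fun j => (i, j) ∈ S ∧ OnDiag i j)).card ≤ 1 := by
    rw [Finset.card_le_one]
    intro a haa b hbb
    simp only [Finset.mem_filter, Finset.mem_univ, true_and] at haa hbb
    exact hd i a b haa.1 hbb.1 haa.2 hbb.2
  have h2 : (Finset.univ.filter (fun j => (i, j) ∈ S ∧ OnAnti i j)).card ≤ 1 := by
    rw [Finset.card_le_one]
    intro a haa b hbb
    simp only [Finset.mem_filter, Finset.mem_univ, true_and] at haa hbb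
    exact ha i a b haa.1 hbb.1 haa.2 hbb.2
  have := (Finset.card_le_card hsub).trans (Finset.card_union_le _ _)
  omega

/-- Row bound when `K = 1`. -/
lemma row_card_one {N : ℕ} {S : Finset (Fin N × Fin N)} (hS : IsStructuredSupport N 1 S)
    (i : Fin N) : (Finset.univ.filter (fun j => (i, j) ∈ S)).card ≤ 1 := by
  classical
  obtain ⟨hadm, hd, ha, hsym, hc⟩ := hS
  rw [Finset.card_le_one]
  intro a haa b hbb
  simp only [Finset.mem_filter, Finset.mem_univ, true_and] at haa hbb
  have hi : i ∈ S.image Prod.fst := Finset.mem_image.2 ⟨_, haa, rfl⟩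
  have hrev := Finset.card_le_one.1 hc _ hi _ (hsym i hi)
  have hval := congrArg Fin.val hrev
  rw [Fin.val_rev] at hval
  have key : ∀ j, (i, j) ∈ S → OnDiag i j := by
    intro j hj
    rcases hadm _ hj with h | h
    · exact h
    · have := i.2
      simp only [OnAnti] at h
      simp only [OnDiag]
      omega
  exact hd i a b haa hbb (key a haa) (key b hbb)

/-- A symmetric set of odd cardinality contains a fixed point of the reversal. -/
lemma exists_center {N : ℕ} (R : Finset (Fin N)) (hsym : ∀ i ∈ R, i.rev ∈ R)
    (hodd : R.card % 2 = 1) : ∃ i ∈ R, i.rev = i := by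
  classical
  by_contra hcon
  push Not at hcon
  have h1 : (R.filter (fun i => i < i.rev)).card = (R.filter (fun i => ¬ i < i.rev)).card := by
    refine Finset.card_nbij' Fin.rev Fin.rev ?_ ?_ ?_ ?_
    · intro i hi
      simp only [Finset.coe_filter, Set.mem_ofPred_eq, Fin.rev_rev] at hi ⊢
      exact ⟨hsym i hi.1, not_lt.2 hi.2.le⟩
    · intro i hi
      simp only [Finset.coe_filter, Set.mem_ofPred_eq, Fin.rev_rev] at hi ⊢
      exact ⟨hsym i hi.1, lt_of_le_of_ne (not_lt.1 hi.2) (hcon i hi.1)⟩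
    · intro i _
      simp
    · intro i _
      simp
  have h2 := Finset.card_filter_add_card_filter_not (s := R) (fun i => i < i.rev)
  omega

/-- Column bound. -/
lemma col_card {N : ℕ} (j : Fin N) (T : Finset (Fin N))
    (hT : ∀ i ∈ T, IsAdmissible (i, j)) : T.card ≤ 6 := by
  classical
  have hsub : T.image Fin.val ⊆ Finset.Icc (j.val - 1) (j.val + 1) ∪
      Finset.Icc (N - j.val - 2) (N - j.val) := by
    intro x hx
    obtain ⟨i, hi, rfl⟩ := Finset.mem_image.1 hx
    have := hT i hi
    simp only [IsAdmissible, OnDiag, OnAnti] at this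
    simp only [Finset.mem_union, Finset.mem_Icc]
    omega
  have h1 := (Finset.card_le_card hsub).trans (Finset.card_union_le _ _)
  rw [Finset.card_image_of_injective _ Fin.val_injective] at h1
  simp only [Nat.card_Icc] at h1
  omega

theorem kron_map_injective_on_structured_sparse
    (N M K : ℕ) (hN : 0 < N) (hM : 0 < M) (hK : 0 < K)
    (hMN : M ≤ N) (hrate : 5 * M > 8 * K)
    (A : Matrix (Fin M) (Fin N) ℂ)
    (hspark : ∀ T : Finset (Fin N), T.card = M →
        LinearIndependent ℂ (fun j : ↥T => fun p : Fin M => A p j.val))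
    (r₁ r₂ : Fin N × Fin N → ℂ)
    (h₁ : ∃ S : Finset (Fin N × Fin N), IsStructuredSupport N K S ∧
        ∀ p, r₁ p ≠ 0 → p ∈ S)
    (h₂ : ∃ S : Finset (Fin N × Fin N), IsStructuredSupport N K S ∧
        ∀ p, r₂ p ≠ 0 → p ∈ S)
    (heq : ∑ p ∈ Finset.univ.filter (@IsAdmissible N), r₁ p • kronCol A p
         = ∑ p ∈ Finset.univ.filter (@IsAdmissible N), r₂ p • kronCol A p) :
    r₁ = r₂ := by
  classical
  obtain ⟨S₁, hS₁, hr₁⟩ := h₁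
  obtain ⟨S₂, hS₂, hr₂⟩ := h₂
  let X : Fin N → Fin N → ℂ := fun i j => r₁ (i, j) - r₂ (i, j)
  have hXS : ∀ i j, X i j ≠ 0 → (i, j) ∈ S₁ ∨ (i, j) ∈ S₂ := by
    intro i j h
    by_contra hn
    push Not at hn
    apply h
    have a1 : r₁ (i, j) = 0 := by
      by_contra h'
      exact hn.1 (hr₁ _ h')
    have a2 : r₂ (i, j) = 0 := by
      by_contra h'
      exact hn.2 (hr₂ _ h')
    simp [X, a1, a2]
  have hXadm : ∀ i j, X i j ≠ 0 → IsAdmissible (i, j) := by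
    intro i j h
    rcases hXS i j h with h | h
    · exact hS₁.1 _ h
    · exact hS₂.1 _ h
  have hX : ∀ p q, ∑ i, ∑ j, X i j * ((starRingEnd ℂ) (A p i) * A q j) = 0 := by
    intro p q
    have h := congrFun heq (p, q)
    simp only [Finset.sum_apply, Pi.smul_apply, smul_eq_mul, kronCol] at h
    rw [← sub_eq_zero, ← Finset.sum_sub_distrib] at h
    rw [← Fintype.sum_prod_type' (f := fun i j => X i j * ((starRingEnd ℂ) (A p i) * A q j)), ← h]
    symm
    rw [← Finset.sum_subset (Finset.subset_univ (Finset.univ.filter (@IsAdmissible N)))]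
    · refine Finset.sum_congr rfl fun x _ => ?_
      simp only [X]
      ring
    · intro x _ hx
      have : X x.1 x.2 = 0 := by
        by_contra h'
        exact hx (by simpa using hXadm _ _ h')
      simp [this]
  set R₁ := S₁.image Prod.fst with hR₁
  set R₂ := S₂.image Prod.fst with hR₂
  have hc₁ : R₁.card ≤ K := hS₁.2.2.2.2
  have hc₂ : R₂.card ≤ K := hS₂.2.2.2.2
  have hcR := Finset.card_union_add_card_inter R₁ R₂
  have hR : ∀ i j, X i j ≠ 0 → i ∈ R₁ ∪ R₂ := by
    intro i j h
    rcases hXS i j h with h | h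
    · exact Finset.mem_union_left _ (Finset.mem_image.2 ⟨_, h, rfl⟩)
    · exact Finset.mem_union_right _ (Finset.mem_image.2 ⟨_, h, rfl⟩)
  -- row bounds
  let row : Fin N → Finset (Fin N) := fun i => Finset.univ.filter (fun j => X i j ≠ 0)
  have hrowsub : ∀ i, row i ⊆ Finset.univ.filter (fun j => (i, j) ∈ S₁) ∪
      Finset.univ.filter (fun j => (i, j) ∈ S₂) := by
    intro i j hj
    simp only [row, Finset.mem_filter, Finset.mem_univ, true_and, Finset.mem_union] at hj ⊢
    exact hXS i j hj
  have hrow : ∀ i, (row i).card ≤ (Finset.univ.filter (fun j => (i, j) ∈ S₁)).card +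
      (Finset.univ.filter (fun j => (i, j) ∈ S₂)).card := fun i =>
    (Finset.card_le_card (hrowsub i)).trans (Finset.card_union_le _ _)
  have hrow4 : ∀ i, (row i).card ≤ 4 := by
    intro i
    have := hrow i
    have := row_card hS₁ i
    have := row_card hS₂ i
    omega
  have hrow2 : (R₁ ∩ R₂).card = 0 ∨ K = 1 → ∀ i, (row i).card ≤ 2 := by
    rintro (h0 | rfl) i
    · have hr := hrow i
      have b1 := row_card hS₁ i
      have b2 := row_card hS₂ i
      by_cases hi : i ∈ R₁
      · have hi2 : i ∉ R₂ := by
          intro hi2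
          have := Finset.card_eq_zero.1 h0
          have hm := Finset.mem_inter.2 ⟨hi, hi2⟩
          rw [this] at hm
          simp at hm
        have : Finset.univ.filter (fun j => (i, j) ∈ S₂) = ∅ := by
          rw [Finset.filter_eq_empty_iff]
          intro j _ hj
          exact hi2 (Finset.mem_image.2 ⟨_, hj, rfl⟩)
        rw [this] at hr
        simp only [Finset.card_empty] at hr
        omega
      · have : Finset.univ.filter (fun j => (i, j) ∈ S₁) = ∅ := by
          rw [Finset.filter_eq_empty_iff]
          intro j _ hj
          exact hi (Finset.mem_image.2 ⟨_, hj, rfl⟩)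
        rw [this] at hr
        simp only [Finset.card_empty] at hr
        omega
    · have := hrow i
      have := row_card_one hS₁ i
      have := row_card_one hS₂ i
      omega
  obtain ⟨t, ht⟩ : ∃ t, t = max 1 ((R₁ ∪ R₂).card + 1 - M) := ⟨_, rfl⟩
  have hbound : ∀ I : Finset (Fin N), I.card ≤ t → (I.biUnion row).card ≤ M := by
    intro I hI
    by_cases h : (R₁ ∩ R₂).card = 0 ∨ K = 1
    · have := Finset.card_biUnion_le_card_mul I row 2 (fun i _ => hrow2 h i)
      omega
    · have := Finset.card_biUnion_le_card_mul I row 4 (fun i _ => hrow4 i)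
      omega
  obtain ⟨b, -, -, hspan, hbli⟩ := exists_linearIndepOn_extension
    (K := ℂ) (v := X) (linearIndepOn_empty ℂ X) (Set.empty_subset Set.univ)
  have hIb : ((b.toFinset : Finset (Fin N)) : Set (Fin N)) = b := by simp
  have hlt : b.toFinset.card < t := by
    by_contra hge
    push Not at hge
    obtain ⟨I, hIsub, hIcard⟩ := Finset.exists_subset_card_eq hge
    have hIli : LinearIndepOn ℂ X (I : Set (Fin N)) := hbli.mono (by
      rw [← hIb]
      exact_mod_cast hIsub)
    refine no_indep_rows hMN A hspark X hX (R₁ ∪ R₂) hR I (I.biUnion row) hIli ?_ ?_ ?_ ?_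
      (hbound I hIcard.le)
    · rw [← Finset.card_pos]; omega
    · intro i hi
      have := hIli.ne_zero (i := i) (by exact_mod_cast hi)
      obtain ⟨j, hj⟩ := Function.ne_iff.1 this
      exact hR i j hj
    · omega
    · intro i hi j hj
      exact Finset.mem_biUnion.2 ⟨i, hi, by simpa [row] using hj⟩
  have hcols : ∀ i j, X i j ≠ 0 → j ∈ b.toFinset.biUnion row := by
    intro i j h
    by_contra hn
    apply h
    have hle : Submodule.span ℂ (X '' b) ≤ LinearMap.ker (LinearMap.proj (R := ℂ) (φ := fun _ : Fin N => ℂ) j) := by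
      rw [Submodule.span_le]
      rintro _ ⟨k, hk, rfl⟩
      simp only [SetLike.mem_coe, LinearMap.mem_ker, LinearMap.proj_apply]
      by_contra h'
      exact hn (Finset.mem_biUnion.2 ⟨k, by simpa using hk, by simpa [row] using h'⟩)
    exact hle (hspan ⟨i, trivial, rfl⟩)
  have hY : ∀ p j, ∑ i, X i j * (starRingEnd ℂ) (A p i) = 0 := by
    intro p
    refine spark_aux hMN A hspark (fun j => ∑ i, X i j * (starRingEnd ℂ) (A p i))
      (b.toFinset.biUnion row) (hbound _ hlt.le) ?_ ?_
    · intro j hj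
      obtain ⟨i, -, hi⟩ := Finset.exists_ne_zero_of_sum_ne_zero hj
      exact hcols i j (left_ne_zero_of_mul hi)
    · intro q
      rw [← hX p q]
      simp only [Finset.sum_mul]
      rw [Finset.sum_comm]
      simp only [mul_assoc]
  have hcol : ∀ j, (Finset.univ.filter (fun i => X i j ≠ 0)).card ≤ M := by
    intro j
    have h6 := col_card j (Finset.univ.filter (fun i => X i j ≠ 0)) (by
      intro i hi
      exact hXadm i j (by simpa using hi))
    have hle : (Finset.univ.filter (fun i => X i j ≠ 0)).card ≤ (R₁ ∪ R₂).card := by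
      apply Finset.card_le_card
      intro i hi
      exact hR i j (by simpa using hi)
    by_contra hgt
    have hK3 : R₁.card = 3 ∧ R₂.card = 3 ∧ (R₁ ∩ R₂).card = 0 := by omega
    obtain ⟨c, hc, hcr⟩ := exists_center R₁ hS₁.2.2.2.1 (by omega)
    obtain ⟨d, hd, hdr⟩ := exists_center R₂ hS₂.2.2.2.1 (by omega)
    have hcd : c = d := by
      apply Fin.ext
      have e1 := congrArg Fin.val hcr
      have e2 := congrArg Fin.val hdr
      rw [Fin.val_rev] at e1 e2
      have := c.2
      have := d.2
      omega
    have hm := Finset.mem_inter.2 ⟨hc, hcd ▸ hd⟩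
    rw [Finset.card_eq_zero.1 hK3.2.2] at hm
    simp at hm
  funext ⟨i, j⟩
  have := spark_conj hMN A hspark (fun i => X i j) _ (hcol j) (by
    intro i hi
    simpa using hi) (fun p => hY p j) i
  exact sub_eq_zero.1 this
end
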